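/- (Equivalence of Fixed Point Representations) Fix a binary relation R on State, a recursion variable X, a valuation V, and a chop formula Ψ = ⋁_{1≤j≤n} φ_j ∈ CF_{(R,X)}. Define the sequence γ⁰ = ∅, γ^{i+1} = ⟦Ψ⟧_{V[X↦γ^i]}, and the sequence of sets of primitive chop formulas C⁰ = ∅, C^{i+1} = ⋃_{1≤j≤n} { φ_j with each occurrence of X replaced by some (possibly different) element of C^i }. Then for every i ≥ 0: γ^i = ⋃_{c ∈ C^i} ⟦c⟧_V. -/

import Mathlib

/-- A trace is a nonempty finite list of states (an element of `State⁺`). -/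
abbrev Trace (State : Type) : Type := {l : List State // l ≠ []}

/-- Trace formulas: `Φ ::= p | R | Φ∧Φ | Φ∨Φ | Φ⌢Φ | X | μX.Φ`. -/
inductive TF (State RVar : Type) : Type where
  | pred : (State → Prop) → TF State RVar
  | rel  : (State → State → Prop) → TF State RVar
  | conj : TF State RVar → TF State RVar → TF State RVar
  | disj : TF State RVar → TF State RVar → TF State RVar
  | chop : TF State RVar → TF State RVar → TF State RVar
  | var  : RVar → TF State RVar
  | mu   : RVar → TF State RVar → TF State RVar

/-- Chop of trace sets: `A ⋈ B = {σ·s·σ' | σ·s ∈ A ∧ s·σ' ∈ B}`,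
the two parts overlapping in the single shared state `s`. -/
def chopSet {State : Type} (A B : Set (Trace State)) : Set (Trace State) :=
  {t | ∃ (σ σ' : List State) (s : State),
    t.1 = σ ++ s :: σ' ∧
    (⟨σ ++ [s], by simp⟩ : Trace State) ∈ A ∧
    (⟨s :: σ', by simp⟩ : Trace State) ∈ B}

/-- Semantics of trace formulas under a valuation `V : RVar → 𝒫(State⁺)`. -/
def sem {State RVar : Type} [DecidableEq RVar] :
    TF State RVar → (RVar → Set (Trace State)) → Set (Trace State)
  | TF.pred p, _ => {t | ∃ (s : State) (σ : List State), t.1 = s :: σ ∧ p s}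
  | TF.rel R, _ => {t | ∃ s s', t.1 = [s, s'] ∧ R s s'}
  | TF.conj a b, V => sem a V ∩ sem b V
  | TF.disj a b, V => sem a V ∪ sem b V
  | TF.chop a b, V => chopSet (sem a V) (sem b V)
  | TF.var X, V => V X
  | TF.mu X a, V => ⋂₀ {γ : Set (Trace State) | sem a (Function.update V X γ) ⊆ γ}

/-- Atoms of primitive chop formulas over a fixed relation `R`
and recursion variable `X`: either `R` or `X`. A primitive chop formula
`S₁⌢…⌢S_k` is a (nonempty) list of atoms; since `grammatize` sends it to
the word `S₁S₂⋯S_k` over terminal `R` and nonterminal `X`, words of the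
grammar are lists of atoms as well. -/
inductive Atom : Type where
  | r : Atom
  | x : Atom
deriving DecidableEq

/-- The trace formula denoted by an atom. -/
def Atom.toTF {State RVar : Type} (R : State → State → Prop) (X : RVar) :
    Atom → TF State RVar
  | Atom.r => TF.rel R
  | Atom.x => TF.var X

/-- The trace formula `S₁⌢…⌢S_k` denoted by a primitive chop formula
(the empty list is mapped to a junk formula with empty semantics). -/
def pcfToTF {State RVar : Type} (R : State → State → Prop) (X : RVar) :
    List Atom → TF State RVar
  | [] => TF.pred fun _ => False
  | [a] => a.toTF R X
  | a :: b :: rest => TF.chop (a.toTF R X) (pcfToTF R X (b :: rest))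

/-- The trace formula `⋁_{1≤j≤n} φ_j` denoted by a chop formula, i.e. by a
finite disjunction of primitive chop formulas. -/
def cfToTF {State RVar : Type} (R : State → State → Prop) (X : RVar) :
    List (List Atom) → TF State RVar
  | [] => TF.pred fun _ => False
  | [c] => pcfToTF R X c
  | c :: d :: rest => TF.disj (pcfToTF R X c) (cfToTF R X (d :: rest))

/-- `SubstX S φ ψ`: `ψ` is obtained from `φ` by replacing each occurrence of
the atom `X` by some (possibly different) element of `S`. -/
inductive SubstX (S : Set (List Atom)) : List Atom → List Atom → Prop where
  | nil : SubstX S [] []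
  | r {φ ψ : List Atom} : SubstX S φ ψ → SubstX S (Atom.r :: φ) (Atom.r :: ψ)
  | x {φ ψ : List Atom} (c : List Atom) :
      c ∈ S → SubstX S φ ψ → SubstX S (Atom.x :: φ) (c ++ ψ)

/-- Derivability of sentential forms in the grammar `gr(Ψ)` with single
nonterminal `X`, single terminal `R`, initial nonterminal `X`, and one
production `X → S₁⋯S_k` for each disjunct `S₁⌢…⌢S_k` of `Ψ`. -/
inductive Derives (Ψ : List (List Atom)) : List Atom → Prop where
  | start : Derives Ψ [Atom.x]
  | step {u v c : List Atom} :
      c ∈ Ψ → Derives Ψ (u ++ Atom.x :: v) → Derives Ψ (u ++ c ++ v)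

/-- `L(gr(Ψ)) ⊆ {R}*`: the terminal words derivable from `X` in `gr(Ψ)`. -/
def Lang (Ψ : List (List Atom)) : Set (List Atom) :=
  {w | Derives Ψ w ∧ Atom.x ∉ w}

theorem chopSet_assoc' {State : Type} (A B D : Set (Trace State)) :
    chopSet (chopSet A B) D = chopSet A (chopSet B D) := by
  ext t
  constructor
  · rintro ⟨σ, σ', s, ht, ⟨τ, τ', u, h1, hA, hB⟩, hD⟩
    simp only at h1
    rcases List.eq_nil_or_concat τ' with rfl | ⟨τ'', w, rfl⟩
    · obtain ⟨rfl, h⟩ := List.append_inj' h1 rfl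
      obtain rfl : s = u := by simpa using h
      exact ⟨σ, σ', s, ht, hA, [], σ', s, rfl, hB, hD⟩
    · have h2 : σ ++ [s] = (τ ++ u :: τ'') ++ [w] := by simpa using h1
      obtain ⟨rfl, h⟩ := List.append_inj' h2 rfl
      obtain rfl : s = w := by simpa using h
      refine ⟨τ, τ'' ++ s :: σ', u, by simpa using ht, hA, u :: τ'', σ', s, by simp, ?_, hD⟩
      simpa using hB
  · rintro ⟨σ, σ', s, ht, hA, ⟨τ, τ', u, h1, hB, hD⟩⟩
    simp only at h1
    rcases τ with _ | ⟨w, τ''⟩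
    · simp only [List.nil_append, List.cons.injEq] at h1
      obtain ⟨rfl, rfl⟩ := h1
      exact ⟨σ, σ', s, ht, ⟨σ, [], s, rfl, hA, hB⟩, hD⟩
    · simp only [List.cons_append, List.cons.injEq] at h1
      obtain ⟨rfl, rfl⟩ := h1
      exact ⟨σ ++ s :: τ'', τ', u, by simpa using ht,
        ⟨σ, τ'' ++ [u], s, by simp, hA, by simpa using hB⟩, hD⟩

theorem sem_pcf_cons {State RVar : Type} [DecidableEq RVar]
    (R : State → State → Prop) (X : RVar) (V : RVar → Set (Trace State))
    (a : Atom) (d : List Atom) (hd : d ≠ []) :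
    sem (pcfToTF R X (a :: d)) V = chopSet (sem (a.toTF R X) V) (sem (pcfToTF R X d) V) := by
  cases d with
  | nil => exact absurd rfl hd
  | cons b d => simp [pcfToTF, sem]

theorem sem_pcf_append {State RVar : Type} [DecidableEq RVar]
    (R : State → State → Prop) (X : RVar) (V : RVar → Set (Trace State))
    (c d : List Atom) (hc : c ≠ []) (hd : d ≠ []) :
    sem (pcfToTF R X (c ++ d)) V
      = chopSet (sem (pcfToTF R X c) V) (sem (pcfToTF R X d) V) := by
  induction c with
  | nil => exact absurd rfl hc
  | cons a c ih =>
    by_cases h : c = []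
    · subst h
      exact sem_pcf_cons R X V a d hd
    · rw [List.cons_append, sem_pcf_cons R X V a _ (by simp [h]), ih h,
        sem_pcf_cons R X V a c h, chopSet_assoc']

theorem SubstX.ne_nil' {S : Set (List Atom)} (hS : ∀ c ∈ S, c ≠ []) {φ ψ : List Atom}
    (h : SubstX S φ ψ) (hφ : φ ≠ []) : ψ ≠ [] := by
  cases h with
  | nil => exact absurd rfl hφ
  | r _ => simp
  | x c hc _ => simp [hS c hc]

theorem mem_sem_subst {State RVar : Type} [DecidableEq RVar]
    (R : State → State → Prop) (X : RVar) (V : RVar → Set (Trace State))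
    (S : Set (List Atom)) (hS : ∀ c ∈ S, c ≠ []) (φ : List Atom) (hφ : φ ≠ [])
    (t : Trace State) :
    t ∈ sem (pcfToTF R X φ) (Function.update V X (⋃ c ∈ S, sem (pcfToTF R X c) V)) ↔
      ∃ ψ, SubstX S φ ψ ∧ t ∈ sem (pcfToTF R X ψ) V := by
  induction φ generalizing t with
  | nil => exact absurd rfl hφ
  | cons a φ ih =>
    by_cases h : φ = []
    · subst h
      cases a with
      | r =>
        constructor
        · intro ht
          exact ⟨[Atom.r], .r .nil, by simpa [pcfToTF, Atom.toTF, sem] using ht⟩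
        · rintro ⟨ψ, hψ, ht⟩
          cases hψ with
          | r h' =>
            cases h'
            simpa [pcfToTF, Atom.toTF, sem] using ht
      | x =>
        simp only [pcfToTF, Atom.toTF, sem, Function.update_self, Set.mem_iUnion]
        constructor
        · rintro ⟨c, hc, ht⟩
          exact ⟨c ++ [], .x c hc .nil, by simpa using ht⟩
        · rintro ⟨ψ, hψ, ht⟩
          cases hψ with
          | x c hc h' =>
            cases h'
            exact ⟨c, hc, by simpa using ht⟩
    · rw [sem_pcf_cons _ _ _ _ _ h]
      constructor
      · rintro ⟨σ, σ', s, ht, hA, hB⟩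
        obtain ⟨ψ, hψ, hB⟩ := (ih h _).1 hB
        have hn := hψ.ne_nil' hS h
        cases a with
        | r =>
          refine ⟨_, .r hψ, ?_⟩
          rw [sem_pcf_cons _ _ _ _ _ hn]
          exact ⟨σ, σ', s, ht, by simpa only [Atom.toTF, sem] using hA, hB⟩
        | x =>
          simp only [Atom.toTF, sem, Function.update_self, Set.mem_iUnion] at hA
          obtain ⟨c, hc, hA⟩ := hA
          refine ⟨_, .x c hc hψ, ?_⟩
          rw [sem_pcf_append _ _ _ _ _ (hS c hc) hn]
          exact ⟨σ, σ', s, ht, hA, hB⟩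
      · rintro ⟨ψ, hψ, ht⟩
        cases hψ with
        | r h' =>
          rw [sem_pcf_cons _ _ _ _ _ (h'.ne_nil' hS h)] at ht
          obtain ⟨σ, σ', s, ht, hA, hB⟩ := ht
          exact ⟨σ, σ', s, ht, by simpa only [Atom.toTF, sem] using hA, (ih h _).2 ⟨_, h', hB⟩⟩
        | x c hc h' =>
          rw [sem_pcf_append _ _ _ _ _ (hS c hc) (h'.ne_nil' hS h)] at ht
          obtain ⟨σ, σ', s, ht, hA, hB⟩ := ht
          refine ⟨σ, σ', s, ht, ?_, (ih h _).2 ⟨_, h', hB⟩⟩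
          simp only [Atom.toTF, sem, Function.update_self, Set.mem_iUnion]
          exact ⟨c, hc, hA⟩

theorem mem_sem_cf {State RVar : Type} [DecidableEq RVar]
    (R : State → State → Prop) (X : RVar) (V : RVar → Set (Trace State))
    (Ψ : List (List Atom)) (t : Trace State) :
    t ∈ sem (cfToTF R X Ψ) V ↔ ∃ φ ∈ Ψ, t ∈ sem (pcfToTF R X φ) V := by
  induction Ψ with
  | nil => simp [cfToTF, sem]
  | cons c Ψ ih =>
    cases Ψ with
    | nil => simp [cfToTF]
    | cons d Ψ =>
      rw [cfToTF, sem, Set.mem_union, ih]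
      simp

/-- Equivalence of Fixed Point Representations:
for the sequences `γ⁰ = ∅`, `γ^{i+1} = ⟦Ψ⟧_{V[X↦γ^i]}` and `C⁰ = ∅`,
`C^{i+1} = ⋃_j {φ_j with each occurrence of X replaced by some element of C^i}`,
one has `γ^i = ⋃_{c ∈ C^i} ⟦c⟧_V` for every `i ≥ 0`. -/
theorem gamma_eq_pcf_union {State RVar : Type} [DecidableEq RVar]
    (R : State → State → Prop) (X : RVar) (V : RVar → Set (Trace State))
    (Ψ : List (List Atom)) (hΨ : Ψ ≠ []) (hpcf : ∀ c ∈ Ψ, c ≠ [])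
    (γ : ℕ → Set (Trace State))
    (hγ0 : γ 0 = ∅)
    (hγs : ∀ i, γ (i + 1) = sem (cfToTF R X Ψ) (Function.update V X (γ i)))
    (C : ℕ → Set (List Atom))
    (hC0 : C 0 = ∅)
    (hCs : ∀ i, C (i + 1) = {ψ' | ∃ φ ∈ Ψ, SubstX (C i) φ ψ'}) :
    ∀ i, γ i = ⋃ c ∈ C i, sem (pcfToTF R X c) V := by
  have hne : ∀ i, ∀ c ∈ C i, c ≠ [] := by
    intro i
    induction i with
    | zero => simp [hC0]
    | succ i ih =>
      rw [hCs]
      rintro c ⟨φ, hφ, hs⟩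
      exact hs.ne_nil' ih (hpcf φ hφ)
  intro i
  induction i with
  | zero => simp [hγ0, hC0]
  | succ i ih =>
    ext t
    rw [hγs, ih, mem_sem_cf, hCs]
    simp only [Set.mem_iUnion, Set.mem_setOf_eq, exists_prop]
    constructor
    · rintro ⟨φ, hφ, ht⟩
      obtain ⟨ψ, hψ, ht⟩ := (mem_sem_subst R X V _ (hne i) φ (hpcf φ hφ) t).1 ht
      exact ⟨ψ, ⟨φ, hφ, hψ⟩, ht⟩
    · rintro ⟨ψ, ⟨φ, hφ, hψ⟩, ht⟩
      exact ⟨φ, hφ, (mem_sem_subst R X V _ (hne i) φ (hpcf φ hφ) t).2 ⟨ψ, hψ, ht⟩⟩
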